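/- Fix α ∈ ℝ with |α| < 1. There exists a constant C > 0 (depending only on α) such that every classical solution u of the damped linear Kawahara system satisfies, for all t > 0, ∫₀¹ ( u(x,t)² + (∂ₓu(x,t))² + (∂ₓ²u(x,t))² ) dx ≤ C²·( 1/((1 − α²)·t) + 1 )·∫₀¹ u(x,0)² dx (instantaneous L² → H² smoothing bound). -/

import Mathlib

noncomputable section
namespace Kaw
open intervalIntegral

/-- L2 norm on the unit interval. -/
def nn (f : ℝ → ℝ) : ℝ := Real.sqrt (∫ x in (0:ℝ)..1, f x ^ 2)

lemma int_sq_nonneg (f : ℝ → ℝ) : 0 ≤ ∫ x in (0:ℝ)..1, f x ^ 2 :=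
  intervalIntegral.integral_nonneg (by norm_num) (fun x _ => sq_nonneg _)

lemma nn_nonneg (f : ℝ → ℝ) : 0 ≤ nn f := Real.sqrt_nonneg _

lemma nn_sq (f : ℝ → ℝ) : nn f ^ 2 = ∫ x in (0:ℝ)..1, f x ^ 2 :=
  Real.sq_sqrt (int_sq_nonneg f)

lemma cs (f g : ℝ → ℝ) (hf : Continuous f) (hg : Continuous g) :
    |∫ x in (0:ℝ)..1, f x * g x| ≤ nn f * nn g := by
  have key : ∀ l : ℝ, 0 ≤ (∫ x in (0:ℝ)..1, g x ^ 2) * (l * l)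
      + (2 * ∫ x in (0:ℝ)..1, f x * g x) * l + ∫ x in (0:ℝ)..1, f x ^ 2 := by
    intro l
    have h := int_sq_nonneg (fun x => f x + l * g x)
    have e : (∫ x in (0:ℝ)..1, (f x + l * g x) ^ 2) = (∫ x in (0:ℝ)..1, g x ^ 2) * (l * l)
      + (2 * ∫ x in (0:ℝ)..1, f x * g x) * l + ∫ x in (0:ℝ)..1, f x ^ 2 := by
      have e1 : ∀ x, (f x + l * g x) ^ 2
        = (l * l) * g x ^ 2 + (2 * l) * (f x * g x) + f x ^ 2 := fun x => by ring
      simp_rw [e1]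
      rw [intervalIntegral.integral_add, intervalIntegral.integral_add,
        intervalIntegral.integral_const_mul, intervalIntegral.integral_const_mul]
      · ring
      all_goals exact Continuous.intervalIntegrable (by fun_prop) _ _
    linarith
  have d := discrim_le_zero key
  rw [discrim, ← nn_sq, ← nn_sq] at d
  refine abs_le_of_sq_le_sq ?_ (mul_nonneg (nn_nonneg f) (nn_nonneg g))
  nlinarith

lemma ftc (F f : ℝ → ℝ) (h : ∀ x, HasDerivAt F (f x) x) (hf : Continuous f) :
    ∫ x in (0:ℝ)..1, f x = F 1 - F 0 :=
  intervalIntegral.integral_eq_sub_of_hasDerivAt (fun x _ => h x) (hf.intervalIntegrable _ _)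

lemma cont_of {F f : ℝ → ℝ} (h : ∀ x, HasDerivAt F (f x) x) : Continuous F :=
  continuous_iff_continuousAt.2 fun x => (h x).continuousAt

lemma nn_mono (f g : ℝ → ℝ) (hf : Continuous f) (hg : Continuous g)
    (h : ∀ x ∈ Set.Icc (0:ℝ) 1, |f x| ≤ |g x|) : nn f ≤ nn g := by
  apply Real.sqrt_le_sqrt
  apply intervalIntegral.integral_mono_on (by norm_num)
  · exact Continuous.intervalIntegrable (by fun_prop) _ _
  · exact Continuous.intervalIntegrable (by fun_prop) _ _
  · intro x hx; exact sq_le_sq.2 (h x hx)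

lemma nn_add (f g : ℝ → ℝ) (hf : Continuous f) (hg : Continuous g) :
    nn (fun x => f x + g x) ≤ nn f + nn g := by
  apply le_of_sq_le_sq _ (add_nonneg (nn_nonneg f) (nn_nonneg g))
  rw [nn_sq]
  have e1 : ∀ x, (f x + g x) ^ 2 = f x ^ 2 + 2 * (f x * g x) + g x ^ 2 := fun x => by ring
  simp_rw [e1]
  rw [intervalIntegral.integral_add, intervalIntegral.integral_add,
    intervalIntegral.integral_const_mul, ← nn_sq, ← nn_sq]
  · have := le_of_abs_le (cs f g hf hg)
    nlinarith
  all_goals exact Continuous.intervalIntegrable (by fun_prop) _ _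

/-- boundary trace -/
lemma trace (f f' : ℝ → ℝ) (h : ∀ x, HasDerivAt f (f' x) x) (hf' : Continuous f') :
    f 1 ^ 2 + f 0 ^ 2 ≤ 2 * nn f ^ 2 + 2 * (nn f * nn f') := by
  have hf := cont_of h
  have e := ftc (fun x => (2 * x - 1) * f x ^ 2)
    (fun x => 2 * f x ^ 2 + 2 * (((2 * x - 1) * f x) * f' x))
    (fun x => by
      have := ((((hasDerivAt_id x).const_mul 2).sub_const 1).mul ((h x).pow 2))
      exact this.congr_deriv (by simp; ring)) (by fun_prop)
  rw [intervalIntegral.integral_add, intervalIntegral.integral_const_mul,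
    intervalIntegral.integral_const_mul, ← nn_sq] at e
  · have c := le_of_abs_le (cs (fun x => (2 * x - 1) * f x) f' (by fun_prop) hf')
    have m := nn_mono (fun x => (2 * x - 1) * f x) f (by fun_prop) hf (by
      intro x hx
      rw [abs_mul]
      have : |2 * x - 1| ≤ 1 := abs_le.2 ⟨by linarith [hx.1], by linarith [hx.2]⟩
      nlinarith [abs_nonneg (f x)])
    have := mul_le_mul_of_nonneg_right m (nn_nonneg f')
    norm_num at e
    linarith
  all_goals exact Continuous.intervalIntegrable (by fun_prop) _ _

lemma poinc (f f' : ℝ → ℝ) (h : ∀ x, HasDerivAt f (f' x) x) (hf' : Continuous f')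
    (h0 : f 0 = 0) : nn f ≤ 2 * nn f' := by
  have hf := cont_of h
  have e := ftc (fun x => (1 - x) * f x ^ 2)
    (fun x => 2 * (((1 - x) * f x) * f' x) - f x ^ 2)
    (fun x => by
      have := ((((hasDerivAt_id x).const_sub 1)).mul ((h x).pow 2))
      exact this.congr_deriv (by simp; ring)) (by fun_prop)
  rw [intervalIntegral.integral_sub, 
    intervalIntegral.integral_const_mul, ← nn_sq] at e
  · have c := le_of_abs_le (cs (fun x => (1 - x) * f x) f' (by fun_prop) hf')
    have m := nn_mono (fun x => (1 - x) * f x) f (by fun_prop) hf (by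
      intro x hx
      rw [abs_mul]
      have : |1 - x| ≤ 1 := abs_le.2 ⟨by linarith [hx.1, hx.2], by linarith [hx.1]⟩
      nlinarith [abs_nonneg (f x)])
    have := mul_le_mul_of_nonneg_right m (nn_nonneg f')
    norm_num [h0] at e
    rcases (nn_nonneg f).eq_or_lt with h | h
    · rw [← h]; linarith [nn_nonneg f']
    · nlinarith
  all_goals exact Continuous.intervalIntegrable (by fun_prop) _ _

/-- one dimensional integration by parts -/
lemma ibp (f f' g g' : ℝ → ℝ) (h : ∀ x, HasDerivAt f (f' x) x) (hf' : Continuous f')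
    (k : ∀ x, HasDerivAt g (g' x) x) (hg' : Continuous g') :
    (∫ x in (0:ℝ)..1, f x * g' x) = f 1 * g 1 - f 0 * g 0 - ∫ x in (0:ℝ)..1, f' x * g x :=
  intervalIntegral.integral_mul_deriv_eq_deriv_mul (fun x _ => h x) (fun x _ => k x)
    (hf'.intervalIntegrable _ _) (hg'.intervalIntegrable _ _)

lemma interp_alg (A0 A1 A2 Q : ℝ) (h0 : 0 ≤ A0) (h1 : 0 ≤ A1) (h2 : 0 ≤ A2)
    (hA : A1 ^ 2 ≤ A0 * A2 + Q) (hQ : Q ^ 2 ≤ 4 * (A0 * (A0 + A1)) * (A1 * (A1 + A2))) :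
    A1 ^ 2 ≤ 400 * (A0 * (A0 + A2)) := by
  by_contra hc
  push Not at hc
  have p02 := mul_nonneg h0 h2
  have a01 : 20 * A0 ≤ A1 := by
    apply le_of_sq_le_sq _ h1
    nlinarith
  have pos : 0 < A1 := by nlinarith
  have q1 : A1 ^ 2 / 2 ≤ Q := by nlinarith
  have q2 : (A1 ^ 2 / 2) ^ 2 ≤ Q ^ 2 := by gcongr
  have q3 : 4 * (A0 * (A0 + A1)) * (A1 * (A1 + A2)) ≤ 4 * (A0 * (A1 / 20 + A1)) * (A1 * (A1 + A2)) := by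
    gcongr; linarith
  have q4 : A1 ^ 2 * (A1 ^ 2 / 4) ≤ A1 ^ 2 * (4.2 * A0 * A1 + 4.2 * (A0 * A2)) := by nlinarith
  have q5 := le_of_mul_le_mul_left q4 (by positivity)
  nlinarith

lemma interp (f f1 f2 : ℝ → ℝ) (h : ∀ x, HasDerivAt f (f1 x) x)
    (h1 : ∀ x, HasDerivAt f1 (f2 x) x) (c2 : Continuous f2) :
    nn f1 ^ 2 ≤ 400 * (nn f * (nn f + nn f2)) := by
  have c1 := cont_of h1
  have c0 := cont_of h
  have t0 := trace f f1 h c1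
  have t1 := trace f1 f2 h1 c2
  have e := ibp f f1 f1 f2 h c1 h1 c2
  have e2 : nn f1 ^ 2 = ∫ x in (0:ℝ)..1, f1 x * f1 x := by
    rw [nn_sq]; simp_rw [sq]
  rw [← e2] at e
  have c := neg_le_of_abs_le (cs f f2 c0 c2)
  apply interp_alg _ _ _ (f 1 * f1 1 - f 0 * f1 0) (nn_nonneg _) (nn_nonneg _) (nn_nonneg _)
  · linarith
  · calc (f 1 * f1 1 - f 0 * f1 0) ^ 2 ≤ (f 1 ^ 2 + f 0 ^ 2) * (f1 1 ^ 2 + f1 0 ^ 2) := by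
          nlinarith [sq_nonneg (f 1 * f1 0 + f 0 * f1 1)]
      _ ≤ (2 * nn f ^ 2 + 2 * (nn f * nn f1)) * (2 * nn f1 ^ 2 + 2 * (nn f1 * nn f2)) := by
          gcongr
          have := nn_nonneg f
          have := nn_nonneg f1
          positivity
      _ = _ := by ring

lemma a3_alg (a2 a3 a4 a5 b : ℝ) (h2 : 0 ≤ a2) (h3 : 0 ≤ a3) (h4 : 0 ≤ a4) (hb : 0 ≤ b)
    (i3 : a3 ^ 2 ≤ 400 * (a2 * (a2 + a4))) (i4 : a4 ^ 2 ≤ 400 * (a3 * (a3 + a5)))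
    (h5 : a5 ≤ b + a3) : a3 ^ 3 ≤ 10 ^ 13 * (a2 ^ 2 * (a2 + b)) := by
  by_cases hM : a3 ≤ a2
  · have : a3 ^ 3 ≤ a2 ^ 3 := by gcongr
    have : 0 ≤ a2 ^ 3 := by positivity
    have : 0 ≤ a2 ^ 2 * b := by positivity
    nlinarith
  push Not at hM
  have pos : 0 < a3 := by linarith
  have j4 : a4 ^ 2 ≤ 400 * (a3 * (2 * a3 + b)) := by
    refine i4.trans ?_
    have : a3 + a5 ≤ 2 * a3 + b := by linarith
    gcongr
  have j3 : (a3 ^ 2) ^ 2 ≤ (400 * (a2 * (a2 + a4))) ^ 2 := by gcongr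
  have j5 : (a2 + a4) ^ 2 ≤ 2 * (a3 ^ 2 + 400 * (a3 * (2 * a3 + b))) := by
    nlinarith [sq_nonneg (a2 - a4)]
  have j6 : a3 * a3 ^ 3 ≤ a3 * (320000 * (a2 ^ 2 * (801 * a3 + 400 * b))) := by
    calc a3 * a3 ^ 3 = (a3 ^ 2) ^ 2 := by ring
      _ ≤ (400 * (a2 * (a2 + a4))) ^ 2 := j3
      _ = 160000 * a2 ^ 2 * (a2 + a4) ^ 2 := by ring
      _ ≤ 160000 * a2 ^ 2 * (2 * (a3 ^ 2 + 400 * (a3 * (2 * a3 + b)))) := by gcongr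
      _ = _ := by ring
  have j7 := le_of_mul_le_mul_left j6 pos
  have n1 : 0 ≤ a2 ^ 2 * b := by positivity
  have n2 : 0 ≤ a2 ^ 3 := by positivity
  by_cases hL : a3 ≤ 30000 * a2
  · have : a2 ^ 2 * a3 ≤ a2 ^ 2 * (30000 * a2) := by gcongr
    nlinarith
  · push Not at hL
    have : (30000 * a2) ^ 2 ≤ a3 ^ 2 := by gcongr
    have : a3 * (30000 * a2) ^ 2 ≤ a3 * a3 ^ 2 := by gcongr
    nlinarith

lemma pq (p q : ℝ) (hp : 0 ≤ p) (hq : 0 ≤ q) : p ^ 3 * q ^ 2 ≤ (p + q) ^ 5 := by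
  calc p ^ 3 * q ^ 2 ≤ (p + q) ^ 3 * (p + q) ^ 2 := by
        gcongr <;> linarith
    _ = _ := by ring

lemma b_alg (β r D a1 a2 a3 b0 b2 : ℝ) (hβ : 0 < β) (hr : 0 ≤ r) (hr1 : r ≤ 1)
    (hD : 1 ≤ D) (hDβ : (10 ^ 14) ^ 2 ≤ D ^ 2 * β ^ 3) (h1 : 0 ≤ a1) (h2 : 0 ≤ a2)
    (h3 : 0 ≤ a3) (hb0 : 0 ≤ b0) (hb2 : 0 ≤ b2)
    (i3 : a3 ^ 3 ≤ 10 ^ 13 * (a2 ^ 2 * (a2 + b0))) (i1 : a1 ≤ 2 * a2)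
    (ib : b0 ^ 2 ≤ b2 * (a3 + a1)) : r ^ 3 * b0 ^ 2 ≤ D * a2 ^ 2 + β * (r ^ 5 * b2 ^ 2) := by
  have hD0 : 0 ≤ D := by linarith
  by_cases hc : b0 ≤ a2
  · have e1 : r ^ 3 * b0 ^ 2 ≤ 1 * a2 ^ 2 := by
      gcongr
      exact pow_le_one₀ hr hr1
    have e2 : 1 * a2 ^ 2 ≤ D * a2 ^ 2 := by gcongr
    have : 0 ≤ β * (r ^ 5 * b2 ^ 2) := by positivity
    linarith
  push Not at hc
  have pos : 0 < b0 := by linarith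
  have c1 : (a3 + a1) ^ 3 ≤ 10 ^ 14 / 2 * (a2 ^ 2 * (a2 + b0)) := by
    have s1 : (a3 + a1) ^ 3 ≤ (a3 + 2 * a2) ^ 3 := by gcongr
    have s2 : (a3 + 2 * a2) ^ 3 ≤ 4 * (a3 ^ 3 + 8 * a2 ^ 3) := by
      nlinarith [mul_nonneg (add_nonneg h3 h2) (sq_nonneg (a3 - 2 * a2)), mul_nonneg h2 (sq_nonneg (a3 - 2 * a2)), mul_nonneg h3 (sq_nonneg (a3 - 2 * a2))]
    have n1 : 0 ≤ a2 ^ 2 * b0 := by positivity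
    have n2 : 0 ≤ a2 ^ 3 := by positivity
    nlinarith
  have c2 : b0 * b0 ^ 5 ≤ b0 * (10 ^ 14 * (b2 ^ 3 * a2 ^ 2)) := by
    calc b0 * b0 ^ 5 = (b0 ^ 2) ^ 3 := by ring
      _ ≤ (b2 * (a3 + a1)) ^ 3 := by gcongr
      _ = b2 ^ 3 * (a3 + a1) ^ 3 := by ring
      _ ≤ b2 ^ 3 * (10 ^ 14 / 2 * (a2 ^ 2 * (b0 + b0))) := by
        refine mul_le_mul_of_nonneg_left (c1.trans ?_) (by positivity)
        gcongr
      _ = _ := by ring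
  have c3 := le_of_mul_le_mul_left c2 pos
  have c4 : (r ^ 3 * b0 ^ 2) ^ 5 ≤ (β * (r ^ 5 * b2 ^ 2) + D * a2 ^ 2) ^ 5 := by
    calc (r ^ 3 * b0 ^ 2) ^ 5 = r ^ 15 * (b0 ^ 5) ^ 2 := by ring
      _ ≤ r ^ 15 * (10 ^ 14 * (b2 ^ 3 * a2 ^ 2)) ^ 2 := by gcongr
      _ = (10 ^ 14) ^ 2 * (r ^ 15 * (b2 ^ 6 * a2 ^ 4)) := by ring
      _ ≤ (D ^ 2 * β ^ 3) * (r ^ 15 * (b2 ^ 6 * a2 ^ 4)) := by gcongr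
      _ = (β * (r ^ 5 * b2 ^ 2)) ^ 3 * (D * a2 ^ 2) ^ 2 := by ring
      _ ≤ _ := pq _ _ (by positivity) (by positivity)
  have := (pow_le_pow_iff_left₀ (by positivity) (by positivity) (by norm_num)).1 c4
  linarith

lemma f_alg (r a0 a1 a2 a3 b0 : ℝ) (hr : 0 < r) (hr1 : r ≤ 1) (h0 : 0 ≤ a0) (h1 : 0 ≤ a1)
    (h2 : 0 ≤ a2) (h3 : 0 ≤ a3) (hb0 : 0 ≤ b0)
    (i3 : a3 ^ 3 ≤ 10 ^ 13 * (a2 ^ 2 * (a2 + b0))) (i2 : a2 ^ 2 ≤ a1 * a3)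
    (i1 : a1 ^ 2 ≤ a0 * a2) :
    a2 ^ 2 ≤ 16 * 10 ^ 52 * (a0 ^ 2 / r ^ 2 + r ^ 3 * b0 ^ 2) := by
  rcases h2.eq_or_lt with hz | pos
  · have hz2 : a2 ^ 2 = 0 := by rw [← hz]; norm_num
    rw [hz2]; positivity
  have c1 : a2 * a2 ^ 3 ≤ a2 * (a0 * a3 ^ 2) := by
    calc a2 * a2 ^ 3 = (a2 ^ 2) ^ 2 := by ring
      _ ≤ (a1 * a3) ^ 2 := by gcongr
      _ = a1 ^ 2 * a3 ^ 2 := by ring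
      _ ≤ (a0 * a2) * a3 ^ 2 := by gcongr
      _ = _ := by ring
  have c2 := le_of_mul_le_mul_left c1 pos
  have c3 : a2 ^ 4 * a2 ^ 5 ≤ a2 ^ 4 * (10 ^ 26 * (a0 ^ 3 * (a2 + b0) ^ 2)) := by
    calc a2 ^ 4 * a2 ^ 5 = (a2 ^ 3) ^ 3 := by ring
      _ ≤ (a0 * a3 ^ 2) ^ 3 := by gcongr
      _ = a0 ^ 3 * (a3 ^ 3) ^ 2 := by ring
      _ ≤ a0 ^ 3 * (10 ^ 13 * (a2 ^ 2 * (a2 + b0))) ^ 2 := by gcongr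
      _ = _ := by ring
  have c4 := le_of_mul_le_mul_left c3 (by positivity)
  by_cases hc : b0 ≤ a2
  · have d1 : a2 ^ 2 * a2 ^ 3 ≤ a2 ^ 2 * (4 * 10 ^ 26 * a0) ^ 3 := by
      calc a2 ^ 2 * a2 ^ 3 = a2 ^ 5 := by ring
        _ ≤ _ := c4
        _ ≤ 10 ^ 26 * (a0 ^ 3 * (a2 + a2) ^ 2) := by gcongr
        _ = a2 ^ 2 * (4 * 10 ^ 26 * a0 ^ 3) := by ring
        _ ≤ a2 ^ 2 * ((4 * 10 ^ 26) ^ 3 * a0 ^ 3) := by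
          gcongr; norm_num
        _ = _ := by ring
    have d2 := le_of_mul_le_mul_left d1 (by positivity)
    have d3 := (pow_le_pow_iff_left₀ (by positivity) (by positivity) (by norm_num)).1 d2
    have d4 : a2 ^ 2 ≤ (4 * 10 ^ 26 * a0) ^ 2 := by gcongr
    have d5 : a0 ^ 2 ≤ a0 ^ 2 / r ^ 2 := by
      rw [le_div_iff₀ (by positivity)]
      have : r ^ 2 ≤ 1 := pow_le_one₀ hr.le hr1
      nlinarith [sq_nonneg a0]
    have d6 : 0 ≤ r ^ 3 * b0 ^ 2 := by positivity
    nlinarith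
  · push Not at hc
    have d1 : a2 ^ 5 ≤ 4 * 10 ^ 26 * (a0 ^ 3 * b0 ^ 2) := by
      calc a2 ^ 5 ≤ _ := c4
        _ ≤ 10 ^ 26 * (a0 ^ 3 * (b0 + b0) ^ 2) := by gcongr
        _ = _ := by ring
    have d2 : (a2 ^ 2) ^ 5 ≤ (16 * 10 ^ 52 * (a0 ^ 2 / r ^ 2 + r ^ 3 * b0 ^ 2)) ^ 5 := by
      calc (a2 ^ 2) ^ 5 = (a2 ^ 5) ^ 2 := by ring
        _ ≤ (4 * 10 ^ 26 * (a0 ^ 3 * b0 ^ 2)) ^ 2 := by gcongr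
        _ = 16 * 10 ^ 52 * ((a0 ^ 2 / r ^ 2) ^ 3 * (r ^ 3 * b0 ^ 2) ^ 2) := by
          field_simp; ring
        _ ≤ 16 * 10 ^ 52 * (a0 ^ 2 / r ^ 2 + r ^ 3 * b0 ^ 2) ^ 5 := by
          gcongr
          exact pq _ _ (by positivity) (by positivity)
        _ ≤ (16 * 10 ^ 52) ^ 5 * (a0 ^ 2 / r ^ 2 + r ^ 3 * b0 ^ 2) ^ 5 := by
          gcongr; norm_num
        _ = _ := by ring
    exact (pow_le_pow_iff_left₀ (by positivity) (by positivity) (by norm_num)).1 d2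

/-- interpolation of the third derivative -/
lemma a3_bound (f : ℕ → ℝ → ℝ) (hf : ∀ k x, HasDerivAt (f k) (f (k + 1) x) x)
    (v : ℝ → ℝ) (hv : Continuous v) (he : ∀ x ∈ Set.Icc (0:ℝ) 1, v x = f 5 x - f 3 x) :
    nn (f 3) ^ 3 ≤ 10 ^ 13 * (nn (f 2) ^ 2 * (nn (f 2) + nn v)) := by
  have hc : ∀ k, Continuous (f k) := fun k => cont_of (hf k)
  refine a3_alg _ _ (nn (f 4)) (nn (f 5)) _ (nn_nonneg _) (nn_nonneg _) (nn_nonneg _) (nn_nonneg _)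
    (interp _ _ _ (hf 2) (hf 3) (hc 4)) (interp _ _ _ (hf 3) (hf 4) (hc 5)) ?_
  have := hc 3
  refine le_trans (nn_mono (f 5) (fun x => v x + f 3 x) (hc 5) (by fun_prop) ?_)
    (nn_add v (f 3) hv (hc 3))
  intro x hx
  rw [he x hx]; simp

lemma a2_bound (f : ℕ → ℝ → ℝ) (hf : ∀ k x, HasDerivAt (f k) (f (k + 1) x) x)
    (h0 : f 1 0 = 0) (h1 : f 1 1 = 0) : nn (f 2) ^ 2 ≤ nn (f 1) * nn (f 3) := by
  have hc : ∀ k, Continuous (f k) := fun k => cont_of (hf k)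
  have e := ibp _ _ _ _ (hf 1) (hc 2) (hf 2) (hc 3)
  have e2 : nn (f 2) ^ 2 = ∫ x in (0:ℝ)..1, f 2 x * f 2 x := by
    rw [nn_sq]; simp_rw [sq]
  simp only [Nat.reduceAdd, ← e2, h0, h1] at e
  have := neg_le_of_abs_le (cs _ _ (hc 1) (hc 3))
  linarith

lemma a1_bound (f : ℕ → ℝ → ℝ) (hf : ∀ k x, HasDerivAt (f k) (f (k + 1) x) x)
    (h0 : f 0 0 = 0) (h1 : f 0 1 = 0) : nn (f 1) ^ 2 ≤ nn (f 0) * nn (f 2) := by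
  have hc : ∀ k, Continuous (f k) := fun k => cont_of (hf k)
  have e := ibp _ _ _ _ (hf 0) (hc 1) (hf 1) (hc 2)
  have e2 : nn (f 1) ^ 2 = ∫ x in (0:ℝ)..1, f 1 x * f 1 x := by
    rw [nn_sq]; simp_rw [sq]
  simp only [Nat.reduceAdd, zero_add, ← e2, h0, h1] at e
  have := neg_le_of_abs_le (cs _ _ (hc 0) (hc 2))
  linarith

lemma b0_bound (f v : ℕ → ℝ → ℝ) (hf : ∀ k x, HasDerivAt (f k) (f (k + 1) x) x)
    (hv : ∀ k x, HasDerivAt (v k) (v (k + 1) x) x)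
    (he : ∀ x ∈ Set.Icc (0:ℝ) 1, v 0 x = f 5 x - f 3 x)
    (v00 : v 0 0 = 0) (v01 : v 0 1 = 0) (v10 : v 1 0 = 0) (v11 : v 1 1 = 0) :
    nn (v 0) ^ 2 ≤ nn (v 2) * (nn (f 3) + nn (f 1)) := by
  have hc : ∀ k, Continuous (f k) := fun k => cont_of (hf k)
  have hcv : ∀ k, Continuous (v k) := fun k => cont_of (hv k)
  have e : nn (v 0) ^ 2 = (∫ x in (0:ℝ)..1, v 0 x * f 5 x) - ∫ x in (0:ℝ)..1, v 0 x * f 3 x := by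
    rw [nn_sq, ← intervalIntegral.integral_sub]
    · apply intervalIntegral.integral_congr
      intro x hx
      rw [Set.uIcc_of_le (by norm_num)] at hx
      simp only
      rw [sq, ← mul_sub]
      nth_rewrite 2 [he x hx]
      rfl
    all_goals
      have := hc 3
      have := hc 5
      have := hcv 0
      exact Continuous.intervalIntegrable (by fun_prop) _ _
  have p1 := ibp _ _ _ _ (hv 0) (hcv 1) (hf 4) (hc 5)
  have p2 := ibp _ _ _ _ (hv 1) (hcv 2) (hf 3) (hc 4)
  have p3 := ibp _ _ _ _ (hv 0) (hcv 1) (hf 2) (hc 3)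
  have p4 := ibp _ _ _ _ (hv 1) (hcv 2) (hf 1) (hc 2)
  simp only [Nat.reduceAdd, zero_add, v00, v01, v10, v11] at p1 p2 p3 p4
  have q1 := le_of_abs_le (cs _ _ (hcv 2) (hc 3))
  have q2 := neg_le_of_abs_le (cs _ _ (hcv 2) (hc 1))
  linarith

lemma energy_space (α : ℝ) (hα : α ^ 2 ≤ 1) (f : ℕ → ℝ → ℝ)
    (hf : ∀ k x, HasDerivAt (f k) (f (k + 1) x) x)
    (v : ℝ → ℝ)  (he : ∀ x ∈ Set.Icc (0:ℝ) 1, v x = f 5 x - f 3 x)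
    (h00 : f 0 0 = 0) (h01 : f 0 1 = 0) (h10 : f 1 0 = 0) (h11 : f 1 1 = 0)
    (h2 : f 2 1 = α * f 2 0) :
    (∫ x in (0:ℝ)..1, (1 + (1 - α ^ 2) * x) * (2 * f 0 x * v x))
      ≤ -(5 * (1 - α ^ 2) * nn (f 2) ^ 2) := by
  have hc : ∀ k, Continuous (f k) := fun k => cont_of (hf k)
  have c0 := hc 0
  have c1 := hc 1
  have c2 := hc 2
  have c3 := hc 3
  have c5 := hc 5
  set β := 1 - α ^ 2 with hβ
  have e := ftc (fun x => 2 * ((1 + β * x) * f 0 x * f 4 x - ((1 + β * x) * f 1 x + β * f 0 x) * f 3 x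
      + 1 / 2 * (1 + β * x) * f 2 x ^ 2 + 2 * β * f 1 x * f 2 x)
      - 2 * ((1 + β * x) * f 0 x * f 2 x - 1 / 2 * (1 + β * x) * f 1 x ^ 2 - β * f 0 x * f 1 x))
    (fun x => (1 + β * x) * (2 * f 0 x * (f 5 x - f 3 x)) + (5 * β) * f 2 x ^ 2
      + (3 * β) * f 1 x ^ 2) (fun x => by
      have w : HasDerivAt (fun x => 1 + β * x) β x := by
        simpa using ((hasDerivAt_id x).const_mul β).const_add 1
      have g0 := hf 0 x
      have g1 := hf 1 x
      have g2 := hf 2 x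
      have g3 := hf 3 x
      have g4 := hf 4 x
      have A := ((((w.fun_mul g0).fun_mul g4).fun_sub (((w.fun_mul g1).fun_add (g0.const_mul β)).fun_mul g3)).fun_add
        ((w.const_mul (1 / 2)).fun_mul (g2.fun_pow 2))).fun_add ((g1.const_mul (2 * β)).fun_mul g2)
      have B := (((w.fun_mul g0).fun_mul g2).fun_sub ((w.const_mul (1 / 2)).fun_mul (g1.fun_pow 2))).fun_sub
        ((g0.const_mul β).fun_mul g1)
      exact ((A.const_mul 2).fun_sub (B.const_mul 2)).congr_deriv (by simp; ring)) (by fun_prop)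
  rw [intervalIntegral.integral_add, intervalIntegral.integral_add,
    intervalIntegral.integral_const_mul, intervalIntegral.integral_const_mul, ← nn_sq, ← nn_sq] at e
  · have ec : (∫ x in (0:ℝ)..1, (1 + β * x) * (2 * f 0 x * v x))
        = ∫ x in (0:ℝ)..1, (1 + β * x) * (2 * f 0 x * (f 5 x - f 3 x)) := by
      apply intervalIntegral.integral_congr
      intro x hx
      rw [Set.uIcc_of_le (by norm_num)] at hx
      simp only [he x hx]
    rw [ec]
    simp only [h00, h01, h10, h11, h2] at e
    have b0 : 0 ≤ β := by linarith
    have n1 : 0 ≤ 3 * β * nn (f 1) ^ 2 := by positivity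
    have n2 : 0 ≤ β ^ 2 * f 2 0 ^ 2 := by positivity
    have ea : α ^ 2 = 1 - β := by linarith
    have e3 : (1 + β) * (α * f 2 0) ^ 2 = f 2 0 ^ 2 - β ^ 2 * f 2 0 ^ 2 := by
      rw [mul_pow, ea]; ring
    linarith
  all_goals exact Continuous.intervalIntegrable (by fun_prop) _ _

/-- partial derivative in space -/
def Dx (u : ℝ → ℝ → ℝ) : ℝ → ℝ → ℝ := fun x t => deriv (fun y => u y t) x
/-- partial derivative in time -/
def Dt (u : ℝ → ℝ → ℝ) : ℝ → ℝ → ℝ := fun x t => deriv (u x) t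

/-- joint smoothness -/
def Sm (u : ℝ → ℝ → ℝ) : Prop := ContDiff ℝ (⊤ : ℕ∞) (Function.uncurry u)

lemma hasDx {u : ℝ → ℝ → ℝ} (hu : Sm u) (x t : ℝ) :
    HasDerivAt (fun y => u y t) (fderiv ℝ (Function.uncurry u) (x, t) (1, 0)) x := by
  have h1 : HasFDerivAt (Function.uncurry u) (fderiv ℝ (Function.uncurry u) (x, t)) (x, t) :=
    (hu.differentiable (by simp) (x, t)).hasFDerivAt
  exact h1.comp_hasDerivAt x ((hasDerivAt_id x).prodMk (hasDerivAt_const x t))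

lemma hasDt {u : ℝ → ℝ → ℝ} (hu : Sm u) (x t : ℝ) :
    HasDerivAt (u x) (fderiv ℝ (Function.uncurry u) (x, t) (0, 1)) t := by
  have h1 : HasFDerivAt (Function.uncurry u) (fderiv ℝ (Function.uncurry u) (x, t)) (x, t) :=
    (hu.differentiable (by simp) (x, t)).hasFDerivAt
  exact h1.comp_hasDerivAt t ((hasDerivAt_const t x).prodMk (hasDerivAt_id t))

lemma Dx_eq {u : ℝ → ℝ → ℝ} (hu : Sm u) (x t : ℝ) :
    Dx u x t = fderiv ℝ (Function.uncurry u) (x, t) (1, 0) := (hasDx hu x t).deriv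
lemma Dt_eq {u : ℝ → ℝ → ℝ} (hu : Sm u) (x t : ℝ) :
    Dt u x t = fderiv ℝ (Function.uncurry u) (x, t) (0, 1) := (hasDt hu x t).deriv

lemma hasDx2 {u : ℝ → ℝ → ℝ} (hu : Sm u) (x t : ℝ) :
    HasDerivAt (fun y => u y t) (Dx u x t) x := by
  rw [Dx_eq hu]; exact hasDx hu x t
lemma hasDt2 {u : ℝ → ℝ → ℝ} (hu : Sm u) (x t : ℝ) :
    HasDerivAt (u x) (Dt u x t) t := by
  rw [Dt_eq hu]; exact hasDt hu x t

lemma Sm_dir {u : ℝ → ℝ → ℝ} (hu : Sm u) (e : ℝ × ℝ) :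
    ContDiff ℝ (⊤ : ℕ∞) (fun p => fderiv ℝ (Function.uncurry u) p e) :=
  (hu.fderiv_right (m := (⊤ : ℕ∞)) (by simp)).clm_apply contDiff_const

lemma Dx_unc {u : ℝ → ℝ → ℝ} (hu : Sm u) :
    Function.uncurry (Dx u) = fun p => fderiv ℝ (Function.uncurry u) p (1, 0) := by
  funext p; exact Dx_eq hu p.1 p.2
lemma Dt_unc {u : ℝ → ℝ → ℝ} (hu : Sm u) :
    Function.uncurry (Dt u) = fun p => fderiv ℝ (Function.uncurry u) p (0, 1) := by
  funext p; exact Dt_eq hu p.1 p.2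

lemma Sm_Dx {u : ℝ → ℝ → ℝ} (hu : Sm u) : Sm (Dx u) := by
  rw [Sm, Dx_unc hu]; exact Sm_dir hu _
lemma Sm_Dt {u : ℝ → ℝ → ℝ} (hu : Sm u) : Sm (Dt u) := by
  rw [Sm, Dt_unc hu]; exact Sm_dir hu _

lemma comm {u : ℝ → ℝ → ℝ} (hu : Sm u) : Dx (Dt u) = Dt (Dx u) := by
  funext x t
  rw [Dx_eq (Sm_Dt hu), Dt_eq (Sm_Dx hu), Dx_unc hu, Dt_unc hu]
  have hd : DifferentiableAt ℝ (fderiv ℝ (Function.uncurry u)) (x, t) :=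
    (hu.fderiv_right (m := (⊤ : ℕ∞)) (by simp)).differentiable (by simp) _
  have hs : IsSymmSndFDerivAt ℝ (Function.uncurry u) (x, t) :=
    (hu.contDiffAt).isSymmSndFDerivAt (by simp only [minSmoothness_of_isRCLikeNormedField]; exact WithTop.coe_le_coe.2 (le_top (a := (2 : ℕ∞))))
  rw [fderiv_clm_apply hd (by fun_prop), fderiv_clm_apply hd (by fun_prop)]
  simpa using hs (1, 0) (0, 1)

lemma Sm_iter {u : ℝ → ℝ → ℝ} (hu : Sm u) (k : ℕ) : Sm (Dx^[k] u) := by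
  induction k with
  | zero => exact hu
  | succ k ih => rw [Function.iterate_succ_apply']; exact Sm_Dx ih

lemma comm_iter {u : ℝ → ℝ → ℝ} (hu : Sm u) (k : ℕ) : Dx^[k] (Dt u) = Dt (Dx^[k] u) := by
  induction k with
  | zero => rfl
  | succ k ih =>
    rw [Function.iterate_succ_apply', ih, comm (Sm_iter hu k), Function.iterate_succ_apply']

lemma iter_eq (u : ℝ → ℝ → ℝ) (k : ℕ) (t : ℝ) :
    iteratedDeriv k (fun y => u y t) = fun x => (Dx^[k] u) x t := by
  induction k with
  | zero => simp
  | succ k ih => rw [iteratedDeriv_succ, ih, Function.iterate_succ_apply']; rfl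

/-- classical solutions -/
structure Sol (α : ℝ) (u : ℝ → ℝ → ℝ) : Prop where
  sm : Sm u
  pde : ∀ x ∈ Set.Icc (0:ℝ) 1, ∀ t, Dt u x t = (Dx^[5] u) x t - (Dx^[3] u) x t
  b00 : ∀ t, u 0 t = 0
  b01 : ∀ t, u 1 t = 0
  b10 : ∀ t, (Dx^[1] u) 0 t = 0
  b11 : ∀ t, (Dx^[1] u) 1 t = 0
  b2 : ∀ t, (Dx^[2] u) 1 t = α * (Dx^[2] u) 0 t

lemma Dt_congr (u w : ℝ → ℝ → ℝ) (x : ℝ) (h : ∀ t, u x t = w x t) (t : ℝ) :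
    Dt u x t = Dt w x t := by
  have : u x = w x := funext h
  simp [Dt, this]

lemma Sol.dt {α : ℝ} {u : ℝ → ℝ → ℝ} (h : Sol α u) : Sol α (Dt u) := by
  refine ⟨Sm_Dt h.sm, ?_, ?_, ?_, ?_, ?_, ?_⟩
  · intro x hx t
    rw [comm_iter h.sm, comm_iter h.sm]
    rw [Dt_congr (Dt u) (fun x t => (Dx^[5] u) x t - (Dx^[3] u) x t) x (h.pde x hx) t]
    exact ((hasDt2 (Sm_iter h.sm 5) x t).fun_sub (hasDt2 (Sm_iter h.sm 3) x t)).deriv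
  · intro t
    rw [Dt_congr u (fun _ _ => 0) 0 h.b00 t]; simp [Dt]
  · intro t
    rw [Dt_congr u (fun _ _ => 0) 1 h.b01 t]; simp [Dt]
  · intro t
    rw [comm_iter h.sm, Dt_congr (Dx^[1] u) (fun _ _ => 0) 0 h.b10 t]; simp [Dt]
  · intro t
    rw [comm_iter h.sm, Dt_congr (Dx^[1] u) (fun _ _ => 0) 1 h.b11 t]; simp [Dt]
  · intro t
    rw [comm_iter h.sm, Dt_congr (Dx^[2] u) (fun _ t => α * (Dx^[2] u) 0 t) 1 h.b2 t]
    exact ((hasDt2 (Sm_iter h.sm 2) 0 t).const_mul α).deriv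

/-- weighted energy -/
def Phi (β : ℝ) (u : ℝ → ℝ → ℝ) (t : ℝ) : ℝ := ∫ x in (0:ℝ)..1, (1 + β * x) * u x t ^ 2

lemma Phi_deriv (β : ℝ) {u : ℝ → ℝ → ℝ} (hu : Sm u) (t : ℝ) :
    HasDerivAt (Phi β u) (∫ x in (0:ℝ)..1, (1 + β * x) * (2 * u x t * Dt u x t)) t := by
  have cu : Continuous (Function.uncurry u) := hu.continuous
  have cv : Continuous (Function.uncurry (Dt u)) := (Sm_Dt hu).continuous
  have cu' : Continuous (fun p : ℝ × ℝ => u p.1 p.2) := cu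
  have cv' : Continuous (fun p : ℝ × ℝ => Dt u p.1 p.2) := cv
  have cF' : Continuous (fun p : ℝ × ℝ => (1 + β * p.1) * (2 * u p.1 p.2 * Dt u p.1 p.2)) := by
    fun_prop
  have cF : Continuous (fun p : ℝ × ℝ => (1 + β * p.1) * u p.1 p.2 ^ 2) := by
    fun_prop
  have cFt : ∀ s, Continuous (fun x => (1 + β * x) * u x s ^ 2) := fun s =>
    cF.comp (continuous_id.prodMk continuous_const)
  have cFt' : ∀ s, Continuous (fun x => (1 + β * x) * (2 * u x s * Dt u x s)) := fun s =>
    cF'.comp (continuous_id.prodMk continuous_const)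
  obtain ⟨M, hM⟩ := ((isCompact_Icc (a := (0:ℝ)) (b := 1)).prod
    (isCompact_Icc (a := t - 1) (b := t + 1))).exists_bound_of_continuousOn cF'.continuousOn
  refine (intervalIntegral.hasDerivAt_integral_of_dominated_loc_of_deriv_le
    (F := fun s x => (1 + β * x) * u x s ^ 2)
    (F' := fun s x => (1 + β * x) * (2 * u x s * Dt u x s)) (bound := fun _ => M)
    (Icc_mem_nhds (show t - 1 < t by linarith) (show t < t + 1 by linarith))
    ?_ ?_ ?_ ?_ ?_ ?_).2
  · exact Filter.Eventually.of_forall fun s => (cFt s).aestronglyMeasurable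
  · exact (cFt t).intervalIntegrable _ _
  · exact (cFt' t).aestronglyMeasurable
  · refine Filter.Eventually.of_forall fun x hx s hs => ?_
    rw [Set.uIoc_of_le (by norm_num)] at hx
    exact hM (x, s) ⟨⟨hx.1.le, hx.2⟩, hs⟩
  · exact intervalIntegrable_const
  · refine Filter.Eventually.of_forall fun x _ s _ => ?_
    exact (((hasDt2 hu x s).fun_pow 2).const_mul (1 + β * x)).congr_deriv (by simp)

lemma cont_slice {u : ℝ → ℝ → ℝ} (hu : Sm u) (t : ℝ) : Continuous (fun x => u x t) :=
  cont_of (fun x => hasDx2 hu x t)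

lemma Phi_ge (β : ℝ) (hβ : 0 ≤ β) {u : ℝ → ℝ → ℝ} (hu : Sm u) (t : ℝ) :
    nn (fun x => u x t) ^ 2 ≤ Phi β u t := by
  have := cont_slice hu t
  rw [nn_sq]
  apply intervalIntegral.integral_mono_on (by norm_num)
  · exact Continuous.intervalIntegrable (by fun_prop) _ _
  · exact Continuous.intervalIntegrable (by fun_prop) _ _
  · intro x hx
    nlinarith [mul_nonneg (mul_nonneg hβ hx.1) (sq_nonneg (u x t))]

lemma Phi_le (β : ℝ) (hβ : 0 ≤ β) (hβ1 : β ≤ 1) {u : ℝ → ℝ → ℝ} (hu : Sm u) (t : ℝ) :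
    Phi β u t ≤ 2 * nn (fun x => u x t) ^ 2 := by
  have := cont_slice hu t
  rw [nn_sq, ← intervalIntegral.integral_const_mul]
  apply intervalIntegral.integral_mono_on (by norm_num)
  · exact Continuous.intervalIntegrable (by fun_prop) _ _
  · exact Continuous.intervalIntegrable (by fun_prop) _ _
  · intro x hx
    have : β * x ≤ 1 := mul_le_one₀ hβ1 hx.1 hx.2
    gcongr
    linarith

lemma slices {u : ℝ → ℝ → ℝ} (hu : Sm u) (t : ℝ) (k : ℕ) (x : ℝ) :
    HasDerivAt (fun x => (Dx^[k] u) x t) ((Dx^[k + 1] u) x t) x := by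
  rw [Function.iterate_succ_apply']
  exact hasDx2 (Sm_iter hu k) x t

lemma Sol.energy {α : ℝ} {u : ℝ → ℝ → ℝ} (h : Sol α u) (hα : α ^ 2 ≤ 1) (t : ℝ) :
    ∃ d, HasDerivAt (Phi (1 - α ^ 2) u) d t ∧
      d ≤ -(5 * (1 - α ^ 2) * nn (fun x => (Dx^[2] u) x t) ^ 2) :=
  ⟨_, Phi_deriv (1 - α ^ 2) h.sm t,
    energy_space α hα (fun k x => (Dx^[k] u) x t) (slices h.sm t) (fun x => Dt u x t)
      (fun x hx => h.pde x hx t) (h.b00 t) (h.b01 t) (h.b10 t) (h.b11 t) (h.b2 t)⟩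

lemma Sol.mono {α : ℝ} {u : ℝ → ℝ → ℝ} (h : Sol α u) (hα : α ^ 2 ≤ 1) :
    Antitone (Phi (1 - α ^ 2) u) := by
  apply antitone_of_deriv_nonpos
  · intro t
    exact (Phi_deriv _ h.sm t).differentiableAt
  · intro t
    obtain ⟨d, hd, hle⟩ := h.energy hα t
    rw [hd.deriv]
    have : 0 ≤ 1 - α ^ 2 := by linarith
    have : 0 ≤ 5 * (1 - α ^ 2) * nn (fun x => (Dx^[2] u) x t) ^ 2 := by positivity
    linarith

lemma Sol.smooth {α : ℝ} {u : ℝ → ℝ → ℝ} (h : Sol α u) (hα : α ^ 2 < 1) (D : ℝ) (hD : 1 ≤ D)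
    (hDβ : (10 ^ 14) ^ 2 ≤ D ^ 2 * (1 - α ^ 2) ^ 3) (s r : ℝ) (hr : 0 ≤ r) (hr1 : r ≤ 1) :
    r ^ 5 * nn (fun x => Dt u x (s + r ^ 2)) ^ 2 ≤ D / (1 - α ^ 2) * Phi (1 - α ^ 2) u s := by
  have hβ : 0 < 1 - α ^ 2 := by linarith
  have hβ1 : 1 - α ^ 2 ≤ 1 := by nlinarith [sq_nonneg α]
  set β := 1 - α ^ 2 with hβd
  have hv := h.dt
  have key : ∀ r : ℝ, 0 ≤ r → r ≤ 1 → ∃ d, HasDerivAt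
      (fun r => D / β * Phi β u (s + r ^ 2) + r ^ 5 * Phi β (Dt u) (s + r ^ 2)) d r ∧ d ≤ 0 := by
    intro r hr hr1
    obtain ⟨d1, hd1, l1⟩ := h.energy hα.le (s + r ^ 2)
    obtain ⟨d2, hd2, l2⟩ := hv.energy hα.le (s + r ^ 2)
    rw [← hβd] at hd1 hd2 l1 l2
    have hg : HasDerivAt (fun r : ℝ => s + r ^ 2) (2 * r) r := by
      simpa using ((hasDerivAt_id r).fun_pow 2).const_add s
    have h5 : HasDerivAt (fun r : ℝ => r ^ 5) (5 * r ^ 4) r := by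
      simpa using ((hasDerivAt_id r).fun_pow 5)
    have e1 : HasDerivAt (fun r => Phi β u (s + r ^ 2)) (d1 * (2 * r)) r :=
      HasDerivAt.comp (h₂ := Phi β u) r hd1 hg
    have e2 : HasDerivAt (fun r => Phi β (Dt u) (s + r ^ 2)) (d2 * (2 * r)) r :=
      HasDerivAt.comp (h₂ := Phi β (Dt u)) r hd2 hg
    refine ⟨_, (e1.const_mul (D / β)).fun_add (h5.fun_mul e2), ?_⟩
    have fs := slices h.sm (s + r ^ 2)
    have vs := slices hv.sm (s + r ^ 2)
    have B := b_alg β r D (nn (fun x => (Dx^[1] u) x (s + r ^ 2)))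
      (nn (fun x => (Dx^[2] u) x (s + r ^ 2))) (nn (fun x => (Dx^[3] u) x (s + r ^ 2)))
      (nn (fun x => Dt u x (s + r ^ 2))) (nn (fun x => (Dx^[2] (Dt u)) x (s + r ^ 2)))
      hβ hr hr1 hD hDβ (nn_nonneg _) (nn_nonneg _) (nn_nonneg _) (nn_nonneg _) (nn_nonneg _)
      (a3_bound (fun k x => (Dx^[k] u) x (s + r ^ 2)) fs _ (cont_slice hv.sm _)
        (fun x hx => h.pde x hx _))
      (poinc _ _ (fs 1) (cont_slice (Sm_iter h.sm 2) _) (h.b10 _))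
      (b0_bound (fun k x => (Dx^[k] u) x (s + r ^ 2)) (fun k x => (Dx^[k] (Dt u)) x (s + r ^ 2))
        fs vs (fun x hx => h.pde x hx _) (hv.b00 _) (hv.b01 _) (hv.b10 _) (hv.b11 _))
    have P := Phi_le β hβ.le hβ1 hv.sm (s + r ^ 2)
    set a2 := nn (fun x => (Dx^[2] u) x (s + r ^ 2))
    set b2 := nn (fun x => (Dx^[2] (Dt u)) x (s + r ^ 2))
    set b0 := nn (fun x => Dt u x (s + r ^ 2))
    have D0 : 0 ≤ D / β := by positivity
    calc D / β * (d1 * (2 * r)) + (5 * r ^ 4 * Phi β (Dt u) (s + r ^ 2) + r ^ 5 * (d2 * (2 * r)))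
        ≤ D / β * (-(5 * β * a2 ^ 2) * (2 * r)) + (5 * r ^ 4 * (2 * b0 ^ 2)
          + r ^ 5 * (-(5 * β * b2 ^ 2) * (2 * r))) := by gcongr
      _ = 10 * r * (r ^ 3 * b0 ^ 2 - (D * a2 ^ 2 + β * (r ^ 5 * b2 ^ 2))) := by
        field_simp; ring
      _ ≤ 0 := mul_nonpos_of_nonneg_of_nonpos (by positivity) (by linarith)
  have anti : AntitoneOn
      (fun r => D / β * Phi β u (s + r ^ 2) + r ^ 5 * Phi β (Dt u) (s + r ^ 2)) (Set.Icc 0 1) := by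
    apply antitoneOn_of_deriv_nonpos (convex_Icc 0 1)
    · intro r hr
      obtain ⟨d, hd, _⟩ := key r hr.1 hr.2
      exact hd.continuousAt.continuousWithinAt
    · intro r hr
      rw [interior_Icc] at hr
      obtain ⟨d, hd, _⟩ := key r hr.1.le hr.2.le
      exact hd.differentiableAt.differentiableWithinAt
    · intro r hr
      rw [interior_Icc] at hr
      obtain ⟨d, hd, hle⟩ := key r hr.1.le hr.2.le
      rw [hd.deriv]; exact hle
  have a := anti ⟨le_refl 0, zero_le_one⟩ ⟨hr, hr1⟩ hr
  simp only [ne_eq, OfNat.ofNat_ne_zero, not_false_eq_true, zero_pow, add_zero, zero_mul] at a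
  have g1 := Phi_ge β hβ.le hv.sm (s + r ^ 2)
  have g2 : 0 ≤ D / β * Phi β u (s + r ^ 2) := by
    have := (sq_nonneg _).trans (Phi_ge β hβ.le h.sm (s + r ^ 2))
    positivity
  have g3 : r ^ 5 * nn (fun x => Dt u x (s + r ^ 2)) ^ 2 ≤ r ^ 5 * Phi β (Dt u) (s + r ^ 2) := by
    gcongr
  linarith

lemma Sol.final {α : ℝ} {u : ℝ → ℝ → ℝ} (h : Sol α u) (hα : α ^ 2 < 1) (D : ℝ) (hD : 1 ≤ D)
    (hDβ : (10 ^ 14) ^ 2 ≤ D ^ 2 * (1 - α ^ 2) ^ 3) (t r : ℝ) (hr : 0 < r) (hr1 : r ≤ 1)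
    (hrt : r ^ 2 ≤ t) :
    nn (fun x => u x t) ^ 2 + nn (fun x => (Dx^[1] u) x t) ^ 2 + nn (fun x => (Dx^[2] u) x t) ^ 2
      ≤ (4 + 64 * 10 ^ 52 * (1 + D / (1 - α ^ 2))) * (1 / r ^ 2) * nn (fun x => u x 0) ^ 2 := by
  have hβ : 0 < 1 - α ^ 2 := by linarith
  have hβ1 : 1 - α ^ 2 ≤ 1 := by nlinarith [sq_nonneg α]
  have S := h.smooth hα D hD hDβ (t - r ^ 2) r hr.le hr1
  rw [sub_add_cancel] at S
  have M1 := h.mono hα.le (show (0:ℝ) ≤ t - r ^ 2 by linarith)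
  have M2 := h.mono hα.le (show (0:ℝ) ≤ t by nlinarith)
  have P0 := Phi_le _ hβ.le hβ1 h.sm 0
  have Pt := Phi_ge _ hβ.le h.sm t
  have fs := slices h.sm t
  have i1 := a1_bound (fun k x => (Dx^[k] u) x t) fs (h.b00 t) (h.b01 t)
  have i2 := a2_bound (fun k x => (Dx^[k] u) x t) fs (h.b10 t) (h.b11 t)
  have i3 := a3_bound (fun k x => (Dx^[k] u) x t) fs _ (cont_slice h.dt.sm t)
        (fun x hx => h.pde x hx t)
  have F := f_alg r _ _ _ _ _ hr hr1 (nn_nonneg _) (nn_nonneg _) (nn_nonneg _) (nn_nonneg _)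
    (nn_nonneg _) i3 i2 i1
  simp only [Function.iterate_zero, id_eq] at F i1
  set β := 1 - α ^ 2 with hβd
  set a0 := nn (fun x => u x t)
  set a1 := nn (fun x => (Dx^[1] u) x t)
  set a2 := nn (fun x => (Dx^[2] u) x t)
  set b0 := nn (fun x => Dt u x t)
  set E := nn (fun x => u x 0)
  have D0 : 0 ≤ D / β := by positivity
  have k1 : a0 ^ 2 ≤ 2 * E ^ 2 := by linarith
  have k2 : r ^ 5 * b0 ^ 2 ≤ D / β * (2 * E ^ 2) :=
    S.trans (mul_le_mul_of_nonneg_left (M1.trans P0) D0)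
  have k3 : r ^ 3 * b0 ^ 2 ≤ D / β * (2 * E ^ 2) * (1 / r ^ 2) := by
    rw [mul_one_div, le_div_iff₀ (by positivity)]
    linarith
  have k4 : a0 ^ 2 / r ^ 2 ≤ 2 * E ^ 2 * (1 / r ^ 2) := by
    rw [mul_one_div]; gcongr
  have k5 : a0 ^ 2 ≤ 2 * E ^ 2 * (1 / r ^ 2) := by
    have : 1 ≤ 1 / r ^ 2 := by
      rw [le_div_iff₀ (by positivity)]
      have : r ^ 2 ≤ 1 := pow_le_one₀ hr.le hr1
      linarith
    nlinarith [sq_nonneg E]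
  have k6 : a1 ^ 2 ≤ a0 ^ 2 + a2 ^ 2 := by nlinarith [sq_nonneg (a0 - a2), sq_nonneg a0, sq_nonneg a2]
  have k7 : a2 ^ 2 ≤ 16 * 10 ^ 52 * (2 * E ^ 2 * (1 / r ^ 2) + D / β * (2 * E ^ 2) * (1 / r ^ 2)) :=
    F.trans (by gcongr)
  nlinarith

end Kaw
end

/-- Instantaneous `L² → H²` smoothing bound for classical solutions of the
damped linear Kawahara system. -/
theorem kawahara_smoothing (α : ℝ) (hα : |α| < 1) :
    ∃ C : ℝ, 0 < C ∧ ∀ (u : ℝ → ℝ → ℝ)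
      (hu : ContDiff ℝ (⊤ : ℕ∞) (Function.uncurry u))
      (hpde : ∀ x ∈ Set.Icc (0:ℝ) 1, ∀ t : ℝ,
        deriv (u x) t + iteratedDeriv 3 (fun y => u y t) x
          - iteratedDeriv 5 (fun y => u y t) x = 0)
      (hbc0 : ∀ t : ℝ, u 0 t = 0) (hbc1 : ∀ t : ℝ, u 1 t = 0)
      (hbx0 : ∀ t : ℝ, deriv (fun y => u y t) 0 = 0)
      (hbx1 : ∀ t : ℝ, deriv (fun y => u y t) 1 = 0)
      (hbxx : ∀ t : ℝ, iteratedDeriv 2 (fun y => u y t) 1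
        = α * iteratedDeriv 2 (fun y => u y t) 0),
      ∀ t : ℝ, 0 < t →
        (∫ x in (0:ℝ)..1,
            ((u x t)^2 + (deriv (fun y => u y t) x)^2
              + (iteratedDeriv 2 (fun y => u y t) x)^2))
          ≤ C^2 * (1/((1 - α^2)*t) + 1) * ∫ x in (0:ℝ)..1, (u x 0)^2 := by
  have hα2 : α ^ 2 < 1 := (sq_lt_one_iff_abs_lt_one α).2 hα
  have hβ : 0 < 1 - α ^ 2 := by linarith
  have hβ1 : 1 - α ^ 2 ≤ 1 := by nlinarith [sq_nonneg α]
  obtain ⟨D, hD, hDβ⟩ : ∃ D : ℝ, 1 ≤ D ∧ (10 ^ 14) ^ 2 ≤ D ^ 2 * (1 - α ^ 2) ^ 3 := by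
    refine ⟨10 ^ 14 / (1 - α ^ 2) ^ 2, ?_, ?_⟩
    · rw [le_div_iff₀ (by positivity)]
      have : (1 - α ^ 2) ^ 2 ≤ 1 := pow_le_one₀ hβ.le hβ1
      linarith
    · have : (10 ^ 14 / (1 - α ^ 2) ^ 2) ^ 2 * (1 - α ^ 2) ^ 3 = (10 ^ 14) ^ 2 / (1 - α ^ 2) := by
        field_simp
      rw [this, le_div_iff₀ hβ]
      nlinarith
  have D0 : 0 ≤ D / (1 - α ^ 2) := by positivity
  set C := 4 + 64 * 10 ^ 52 * (1 + D / (1 - α ^ 2)) with hC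
  have hC1 : 1 ≤ C := by nlinarith
  refine ⟨C, by linarith, ?_⟩
  intro u hu hpde hbc0 hbc1 hbx0 hbx1 hbxx t ht
  have h : Kaw.Sol α u := by
    refine ⟨hu, ?_, hbc0, hbc1, hbx0, hbx1, ?_⟩
    · intro x hx t
      have := hpde x hx t
      rw [Kaw.iter_eq, Kaw.iter_eq] at this
      simp only [Kaw.Dt]
      linarith
    · intro t
      have := hbxx t
      rwa [Kaw.iter_eq] at this
  have hr0 : 0 < min t 1 := lt_min ht one_pos
  have hsq : Real.sqrt (min t 1) ^ 2 = min t 1 := Real.sq_sqrt hr0.le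
  have F := h.final hα2 D hD hDβ t (Real.sqrt (min t 1)) (Real.sqrt_pos.2 hr0)
    (Real.sqrt_le_one.2 (min_le_right _ _)) (by rw [hsq]; exact min_le_left _ _)
  rw [hsq, ← hC] at F
  have e : (∫ x in (0:ℝ)..1,
            ((u x t)^2 + (deriv (fun y => u y t) x)^2
              + (iteratedDeriv 2 (fun y => u y t) x)^2))
      = Kaw.nn (fun x => u x t) ^ 2 + Kaw.nn (fun x => (Kaw.Dx^[1] u) x t) ^ 2
        + Kaw.nn (fun x => (Kaw.Dx^[2] u) x t) ^ 2 := by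
    have c0 := Kaw.cont_slice h.sm t
    have c1 := Kaw.cont_slice (Kaw.Sm_iter h.sm 1) t
    have c2 := Kaw.cont_slice (Kaw.Sm_iter h.sm 2) t
    rw [Kaw.nn_sq, Kaw.nn_sq, Kaw.nn_sq, Kaw.iter_eq, ← intervalIntegral.integral_add,
      ← intervalIntegral.integral_add]
    · rfl
    all_goals exact Continuous.intervalIntegrable (by fun_prop) _ _
  rw [e, ← Kaw.nn_sq (fun x => u x 0)]
  refine F.trans ?_
  have m1 : 1 / min t 1 ≤ 1 / ((1 - α ^ 2) * t) + 1 := by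
    have p : 0 < 1 / ((1 - α ^ 2) * t) := by positivity
    rcases le_total t 1 with h1 | h1
    · rw [min_eq_left h1]
      have : 1 / t ≤ 1 / ((1 - α ^ 2) * t) := by
        apply one_div_le_one_div_of_le (by positivity)
        nlinarith
      linarith
    · rw [min_eq_right h1]; norm_num; positivity
  have m2 : C ≤ C ^ 2 := by nlinarith
  gcongr
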